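/- Suppose -(VU)^2 = G_1⋯G_r where each G_i is a conjugate of U in SL(2,ℤ). Then r ≥ 10, and a finite sequence of Hurwitz moves transforms the sequence (G_1,…,G_r) into a sequence (V, U, V, U, D_5,…,D_r) with D_5⋯D_r = -Id (minus the 2×2 identity matrix). -/

import Mathlib

/-- `SL(2,ℤ)`, the group of 2×2 integer matrices of determinant 1. -/
abbrev SL2Z := Matrix.SpecialLinearGroup (Fin 2) ℤ

instance : Fact (Even (Fintype.card (Fin 2))) := ⟨by simp⟩

/-- The matrix `U = [[1,1],[0,1]]`. -/
def U : SL2Z := ⟨!![1, 1; 0, 1], by norm_num [Matrix.det_fin_two_of]⟩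

/-- The matrix `V = [[1,0],[-1,1]]`. -/
def V : SL2Z := ⟨!![1, 0; -1, 1], by norm_num [Matrix.det_fin_two_of]⟩

/-- A single Hurwitz move on a finite sequence of elements of a group: some consecutive
pair `(a, b)` is replaced by `(b, b⁻¹ * a * b)` or by `(a * b * a⁻¹, a)`. -/
def HurwitzMove {G : Type*} [Group G] (L L' : List G) : Prop :=
  ∃ (p : List G) (a b : G) (t : List G),
    L = p ++ a :: b :: t ∧
    (L' = p ++ b :: (b⁻¹ * a * b) :: t ∨ L' = p ++ (a * b * a⁻¹) :: a :: t)

/-- A finite sequence of Hurwitz moves. -/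
def HurwitzEquiv {G : Type*} [Group G] : List G → List G → Prop :=
  Relation.ReflTransGen HurwitzMove

section HurwitzMoves

variable {G : Type*} [Group G]

theorem HurwitzMove.append {L L' : List G} (h : HurwitzMove L L') (p t : List G) :
    HurwitzMove (p ++ L ++ t) (p ++ L' ++ t) := by
  obtain ⟨q, a, b, s, rfl, rfl | rfl⟩ := h
  · exact ⟨p ++ q, a, b, s ++ t, by simp, Or.inl (by simp)⟩
  · exact ⟨p ++ q, a, b, s ++ t, by simp, Or.inr (by simp)⟩

theorem HurwitzEquiv.append {L L' : List G} (h : HurwitzEquiv L L') (p t : List G) :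
    HurwitzEquiv (p ++ L ++ t) (p ++ L' ++ t) :=
  Relation.ReflTransGen.lift (p := HurwitzMove) (fun l => p ++ l ++ t)
    (fun _ _ h => HurwitzMove.append h p t) _ _ h

theorem HurwitzEquiv.trans {L₁ L₂ L₃ : List G} (h : HurwitzEquiv L₁ L₂)
    (h' : HurwitzEquiv L₂ L₃) : HurwitzEquiv L₁ L₃ :=
  Relation.ReflTransGen.trans h h'

theorem HurwitzMove.length_eq {L L' : List G} (h : HurwitzMove L L') :
    L'.length = L.length := by
  obtain ⟨q, a, b, s, rfl, rfl | rfl⟩ := h <;> simp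

theorem HurwitzMove.prod_eq {L L' : List G} (h : HurwitzMove L L') : L'.prod = L.prod := by
  obtain ⟨q, a, b, s, rfl, rfl | rfl⟩ := h <;> simp [mul_assoc]

theorem HurwitzEquiv.length_eq {L L' : List G} (h : HurwitzEquiv L L') :
    L'.length = L.length := by
  induction h with
  | refl => rfl
  | tail _ h ih => exact h.length_eq.trans ih

theorem HurwitzEquiv.prod_eq {L L' : List G} (h : HurwitzEquiv L L') : L'.prod = L.prod := by
  induction h with
  | refl => rfl
  | tail _ h ih => exact h.prod_eq.trans ih

/-- A pair of entries can be moved to the front, conjugating what it passes by its product. -/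
theorem HurwitzEquiv.pair_to_front (p : List G) (a b : G) :
    HurwitzEquiv (p ++ [a, b]) (a :: b :: p.map fun x => (a * b)⁻¹ * x * (a * b)) := by
  induction p with
  | nil => exact Relation.ReflTransGen.refl
  | cons x p ih =>
    refine HurwitzEquiv.trans
      (L₂ := x :: a :: b :: p.map fun x => (a * b)⁻¹ * x * (a * b)) ?_ ?_
    · simpa only [List.append_nil, List.nil_append, List.cons_append] using ih.append [x] []
    · refine Relation.ReflTransGen.tail
        (b := a :: (a⁻¹ * x * a) :: b :: p.map fun x => (a * b)⁻¹ * x * (a * b))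
        (Relation.ReflTransGen.single ⟨[], x, a, _, rfl, Or.inl rfl⟩) ?_
      exact ⟨[a], a⁻¹ * x * a, b, _, rfl, Or.inl (by simp [mul_assoc])⟩

end HurwitzMoves

/-- The element `VU` of order six. -/
def rotMat : SL2Z := V * U

/-- The element of order four exchanging the lines spanned by the standard basis vectors. -/
def flipMat : SL2Z := ⟨!![0, 1; -1, 0], by norm_num [Matrix.det_fin_two_of]⟩

/-- The letters `U` and `V⁻¹` generating the free monoid of nonnegative matrices. -/
def letterMat (b : Bool) : SL2Z := if b then V⁻¹ else U

/-- The nonnegative matrix spelled by a word. -/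
def wordMat (W : List Bool) : SL2Z := (W.map letterMat).prod

/-- A cone in the Farey tessellation: one of the three images of the first quadrant under powers
of `rotMat`, followed by a word describing successive subdivisions. -/
abbrev Cone := Fin 3 × List Bool

/-- The matrix whose columns span a given cone. -/
def coneMat (c : Cone) : SL2Z := rotMat ^ (c.1 : ℕ) * wordMat c.2

/-- Labels for the primitive vectors up to sign: the three vectors of the base Farey triangle, and
the mediants of the cones. -/
inductive Region
  | base (i : Fin 3)
  | node (c : Cone)

namespace Region

/-- A matrix whose first column is the vector labelled by the region. -/
def frame : Region → SL2Z
  | base i => rotMat ^ (i : ℕ)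
  | node c => coneMat c * V⁻¹

/-- The transvection along the vector labelled by the region. -/
def transvection (r : Region) : SL2Z := MulAut.conj r.frame U

/-- The distance of the region to the base triangle. -/
def depth : Region → ℕ
  | base _ => 0
  | node c => c.2.length + 1

/-- The cone into which the transvection of the region maps the complement of `inCone`. -/
def outCone : Region → Cone
  | base i => (i, [])
  | node c => (c.1, c.2 ++ [true])

/-- The cone whose complement is mapped into `outCone` by the transvection of the region. -/
def inCone : Region → Cone
  | base i => (i + 1, [])
  | node c => (c.1, c.2 ++ [false])

/-- The action of `rotMat` on regions. -/
def rotate : Region → Region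
  | base i => base (i + 1)
  | node c => node (c.1 + 1, c.2)

/-- The action of `flipMat` on regions. -/
def flip : Region → Region
  | base 0 => base 2
  | base 1 => node (0, [])
  | base 2 => base 0
  | node (0, []) => base 1
  | node (0, false :: W) => node (2, W)
  | node (0, true :: W) => node (1, W)
  | node (1, W) => node (0, true :: W)
  | node (2, W) => node (0, false :: W)

end Region

theorem conj_neg_eq (g : SL2Z) : MulAut.conj (-g) = MulAut.conj g := by
  ext1 x
  simp [MulAut.conj_apply, inv_neg]

theorem wordMat_append (W X : List Bool) : wordMat (W ++ X) = wordMat W * wordMat X := by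
  simp [wordMat]

theorem wordMat_cons (b : Bool) (X : List Bool) :
    wordMat (b :: X) = letterMat b * wordMat X := by
  simp [wordMat]

theorem coneMat_append (c : Cone) (X : List Bool) :
    coneMat (c.1, c.2 ++ X) = coneMat c * wordMat X := by
  simp [coneMat, wordMat_append, mul_assoc]

theorem conj_coneMat_succ (i : Fin 3) (W : List Bool) :
    MulAut.conj (coneMat (i + 1, W)) = MulAut.conj (rotMat * coneMat (i, W)) := by
  fin_cases i
  · simp [coneMat]
  · simp [coneMat, pow_two, mul_assoc]
  · have h : rotMat * rotMat ^ 2 = -1 := by decide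
    have h' : rotMat * coneMat (2, W) = -coneMat (0, W) := by
      simp only [coneMat, Fin.val_two, Fin.val_zero, ← mul_assoc]
      rw [h]; simp
    exact (conj_neg_eq (coneMat (0, W))).symm.trans (by rw [← h']; rfl)

namespace Region

theorem transvection_rotate (r : Region) :
    r.rotate.transvection = MulAut.conj rotMat r.transvection := by
  match r with
  | base i => fin_cases i <;> decide
  | node (i, W) =>
    simp only [transvection, rotate, frame, map_mul, conj_coneMat_succ, MulAut.mul_apply]

theorem depth_rotate (r : Region) : r.rotate.depth = r.depth := by
  cases r <;> rfl

theorem transvection_flip (r : Region) :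
    r.flip.transvection = MulAut.conj flipMat r.transvection := by
  match r with
  | base 0 => decide
  | base 1 => decide
  | base 2 => decide
  | node (0, []) => decide
  | node (0, false :: W) =>
    have h : flipMat * U = rotMat ^ 2 := by decide
    simp [transvection, flip, frame, coneMat, wordMat_cons, letterMat, ← h, mul_assoc]
  | node (0, true :: W) =>
    have h : flipMat * V⁻¹ = rotMat := by decide
    simp [transvection, flip, frame, coneMat, wordMat_cons, letterMat, ← h, mul_assoc]
  | node (1, W) =>
    have h : V⁻¹ = -(flipMat * rotMat) := by decide
    simp only [transvection, flip, frame, coneMat, wordMat_cons, letterMat, if_true, map_mul,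
      MulAut.mul_apply]
    rw [h, conj_neg_eq]
    simp
  | node (2, W) =>
    have h : U = -(flipMat * rotMat ^ 2) := by decide
    have h' : MulAut.conj U = MulAut.conj (flipMat * rotMat ^ 2) := by
      rw [← conj_neg_eq (_ * _), ← h]
    simp [transvection, flip, frame, coneMat, wordMat_cons, letterMat, h']

theorem depth_flip_le (r : Region) : r.flip.depth ≤ r.depth + 1 := by
  unfold flip
  split <;> simp [depth]

theorem depth_flip_node_zero (W : List Bool) : (node (0, W)).flip.depth ≤ W.length := by
  match W with
  | [] => rfl
  | false :: W => simp [flip, depth]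
  | true :: W => simp [flip, depth]

theorem exists_conj_letterMat (b : Bool) (r : Region) :
    ∃ r' : Region, r'.transvection = MulAut.conj (letterMat b) r.transvection ∧
      r'.depth ≤ r.depth + 1 := by
  cases b
  · have h : U = -(flipMat * (rotMat * rotMat)) := by decide
    refine ⟨r.rotate.rotate.flip, ?_, ?_⟩
    · simp only [transvection_flip, transvection_rotate]
      have h' : MulAut.conj U = MulAut.conj (flipMat * (rotMat * rotMat)) := by
        rw [← conj_neg_eq (_ * _), ← h]
      simp [letterMat, h']
    · simpa only [depth_rotate] using depth_flip_le r.rotate.rotate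
  · have h : V⁻¹ = -(flipMat * rotMat) := by decide
    refine ⟨r.rotate.flip, ?_, ?_⟩
    · simp only [transvection_flip, transvection_rotate, letterMat, if_true]
      rw [h, conj_neg_eq]
      simp
    · simpa only [depth_rotate] using depth_flip_le r.rotate

theorem exists_conj_wordMat (W : List Bool) (r : Region) :
    ∃ r' : Region, r'.transvection = MulAut.conj (wordMat W) r.transvection ∧
      r'.depth ≤ W.length + r.depth := by
  induction W with
  | nil => exact ⟨r, by simp [wordMat], by simp⟩
  | cons b W ih =>
    obtain ⟨r₁, h₁, h₁'⟩ := ih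
    obtain ⟨r₂, h₂, h₂'⟩ := exists_conj_letterMat b r₁
    refine ⟨r₂, ?_, ?_⟩
    · rw [h₂, h₁, wordMat_cons, map_mul, MulAut.mul_apply]
    · simp only [List.length_cons]
      omega

theorem exists_conj_rotation_pow (n : ℕ) (r : Region) :
    ∃ r' : Region, r'.transvection = MulAut.conj (rotMat ^ n) r.transvection ∧
      r'.depth = r.depth := by
  induction n with
  | zero => exact ⟨r, by simp, rfl⟩
  | succ n ih =>
    obtain ⟨r₁, h₁, h₁'⟩ := ih
    refine ⟨r₁.rotate, ?_, (depth_rotate _).trans h₁'⟩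
    rw [transvection_rotate, h₁, pow_succ', map_mul, MulAut.mul_apply]

theorem exists_conj_coneMat_flipMat (c : Cone) (X : List Bool) :
    ∃ r' : Region,
      r'.transvection = MulAut.conj (coneMat c * flipMat) (node (0, X)).transvection ∧
      r'.depth ≤ c.2.length + X.length := by
  obtain ⟨r₁, h₁, h₁'⟩ := exists_conj_wordMat c.2 (node (0, X)).flip
  obtain ⟨r₂, h₂, h₂'⟩ := exists_conj_rotation_pow c.1 r₁
  refine ⟨r₂, ?_, ?_⟩
  · rw [h₂, h₁, transvection_flip]
    simp [coneMat, mul_assoc]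
  · have := depth_flip_node_zero X
    omega

theorem transvection_eq (r : Region) :
    r.transvection = coneMat r.outCone * flipMat * (coneMat r.inCone)⁻¹ ∨
    r.transvection = -(coneMat r.outCone * flipMat * (coneMat r.inCone)⁻¹) := by
  match r with
  | base 0 => decide
  | base 1 => decide
  | base 2 => decide
  | node c =>
    left
    have h : V⁻¹ * U * V = V⁻¹ * flipMat * U⁻¹ := by decide
    have ht : wordMat [true] = V⁻¹ := by simp [wordMat, letterMat]
    have hf : wordMat [false] = U := by simp [wordMat, letterMat]
    simp only [transvection, frame, outCone, inCone, coneMat_append, ht, hf, MulAut.conj_apply,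
      mul_inv_rev, inv_inv]
    calc _ = coneMat c * (V⁻¹ * U * V) * (coneMat c)⁻¹ := by group
      _ = _ := by rw [h]; group

theorem conj_transvection (r : Region) :
    MulAut.conj r.transvection =
      MulAut.conj (coneMat r.outCone * flipMat * (coneMat r.inCone)⁻¹) := by
  rcases r.transvection_eq with h | h
  · rw [h]
  · rw [h, conj_neg_eq]

theorem length_inCone (r : Region) : r.inCone.2.length = r.outCone.2.length := by
  cases r <;> simp [inCone, outCone]

theorem transvection_node_append (c : Cone) (X : List Bool) :
    (node (c.1, c.2 ++ X)).transvection =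
      MulAut.conj (coneMat c) (node (0, X)).transvection := by
  simp only [transvection, frame, coneMat_append, map_mul, MulAut.mul_apply]
  simp [coneMat]

theorem exists_conj_depth_lt (r : Region) (X : List Bool) :
    ∃ r' : Region, r'.transvection =
        MulAut.conj r.transvection (node (r.inCone.1, r.inCone.2 ++ X)).transvection ∧
      r'.depth < (node (r.inCone.1, r.inCone.2 ++ X)).depth := by
  obtain ⟨r', h, h'⟩ := exists_conj_coneMat_flipMat r.outCone X
  refine ⟨r', ?_, ?_⟩
  · rw [h, conj_transvection, transvection_node_append, ← MulAut.mul_apply, ← map_mul,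
      inv_mul_cancel_right]
  · change _ < (_ ++ _ : List Bool).length + 1
    simp only [List.length_append, length_inCone]
    omega

theorem exists_conj_inv_depth_lt (r : Region) (X : List Bool) :
    ∃ r' : Region, r'.transvection =
        MulAut.conj r.transvection⁻¹ (node (r.outCone.1, r.outCone.2 ++ X)).transvection ∧
      r'.depth < (node (r.outCone.1, r.outCone.2 ++ X)).depth := by
  obtain ⟨r', h, h'⟩ := exists_conj_coneMat_flipMat r.inCone X
  have hJ : flipMat = -flipMat⁻¹ := by decide
  have hJ' : MulAut.conj flipMat = MulAut.conj flipMat⁻¹ := by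
    rw [← conj_neg_eq flipMat⁻¹, ← hJ]
  refine ⟨r', ?_, ?_⟩
  · rw [h, map_inv, conj_transvection, transvection_node_append, ← map_inv, ← MulAut.mul_apply,
      ← map_mul, map_mul, hJ', ← map_mul]
    congr 2
    group
  · change _ < (_ ++ _ : List Bool).length + 1
    have := r.length_inCone
    simp only [List.length_append]
    omega

/-- Every conjugate of `U` is the transvection of some region. -/
theorem exists_transvection_eq {A : SL2Z} (h : IsConj U A) :
    ∃ r : Region, r.transvection = A := by
  obtain ⟨g, rfl⟩ := isConj_iff.mp h
  suffices H : (∀ r : Region, ∃ r' : Region, r'.transvection = MulAut.conj g r.transvection) ∧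
      ∀ r : Region, ∃ r' : Region, r'.transvection = MulAut.conj g⁻¹ r.transvection by
    obtain ⟨r', hr'⟩ := H.1 (base 0)
    exact ⟨r', by rw [hr']; simp [transvection, frame]⟩
  have hg : g ∈ Subgroup.closure {ModularGroup.S, ModularGroup.T} := by
    rw [SpecialLinearGroup.SL2Z_generators]; trivial
  induction hg using Subgroup.closure_induction with
  | mem x hx =>
    rcases hx with rfl | rfl
    · have h₁ : ModularGroup.S = -flipMat := by decide
      have h₂ : ModularGroup.S⁻¹ = flipMat := by decide
      exact ⟨fun r => ⟨r.flip, by rw [transvection_flip, h₁, conj_neg_eq]⟩,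
        fun r => ⟨r.flip, by rw [transvection_flip, h₂]⟩⟩
    · have h₁ : ModularGroup.T = letterMat false := by decide
      have h₂ : ModularGroup.T⁻¹ = -(rotMat * flipMat) := by decide
      refine ⟨fun r => ?_, fun r => ⟨r.flip.rotate, ?_⟩⟩
      · obtain ⟨r', h, -⟩ := exists_conj_letterMat false r
        exact ⟨r', by rw [h, h₁]⟩
      · rw [transvection_rotate, transvection_flip, h₂, conj_neg_eq, map_mul, MulAut.mul_apply]
  | one => exact ⟨fun r => ⟨r, by simp⟩, fun r => ⟨r, by simp⟩⟩
  | mul x y _ _ hx hy =>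
    have hx := hx (isConj_iff.mpr ⟨x, rfl⟩)
    have hy := hy (isConj_iff.mpr ⟨y, rfl⟩)
    refine ⟨fun r => ?_, fun r => ?_⟩
    · obtain ⟨r₁, h₁⟩ := hy.1 r
      obtain ⟨r₂, h₂⟩ := hx.1 r₁
      exact ⟨r₂, by rw [h₂, h₁, map_mul, MulAut.mul_apply]⟩
    · obtain ⟨r₁, h₁⟩ := hx.2 r
      obtain ⟨r₂, h₂⟩ := hy.2 r₁
      exact ⟨r₂, by rw [h₂, h₁, mul_inv_rev, map_mul, MulAut.mul_apply]⟩
  | inv x _ hx =>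
    have hx := hx (isConj_iff.mpr ⟨x, rfl⟩)
    exact ⟨hx.2, by simpa using hx.1⟩

end Region

/-- One cone contains the other: equal root and one word a prefix of the other. -/
def Cone.Contains (c d : Cone) : Prop := c.1 = d.1 ∧ c.2 <+: d.2

/-- The linear action of a matrix on vectors. -/
def act (M : SL2Z) (x : Fin 2 → ℤ) : Fin 2 → ℤ := Matrix.mulVec M.1 x

theorem act_mul (M N : SL2Z) (x : Fin 2 → ℤ) : act (M * N) x = act M (act N x) := by
  rw [act, act, act, Matrix.mulVec_mulVec, Matrix.SpecialLinearGroup.coe_mul]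

theorem act_one (x : Fin 2 → ℤ) : act 1 x = x := by
  simp [act]

theorem act_neg (M : SL2Z) (x : Fin 2 → ℤ) : act (-M) x = -act M x := by
  simp [act, Matrix.neg_mulVec]

/-- The product of the coordinates, nonnegative exactly on the closed standard cone. -/
def prodForm (x : Fin 2 → ℤ) : ℤ := x 0 * x 1

theorem prodForm_neg (x : Fin 2 → ℤ) : prodForm (-x) = prodForm x := by
  simp [prodForm]

/-- The quadratic form invariant under `rotMat`. -/
def hexForm (x : Fin 2 → ℤ) : ℤ := x 0 ^ 2 + x 0 * x 1 + x 1 ^ 2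

theorem hexForm_neg (x : Fin 2 → ℤ) : hexForm (-x) = hexForm x := by
  simp [hexForm]

theorem act_rotMat (x : Fin 2 → ℤ) : act rotMat x = ![x 0 + x 1, -x 0] := by
  have h : rotMat.1 = !![1, 1; -1, 0] := by decide
  ext i
  fin_cases i <;> simp [act, h, Matrix.mulVec, dotProduct, Fin.sum_univ_two]

theorem hexForm_rotMat (x : Fin 2 → ℤ) : hexForm (act rotMat x) = hexForm x := by
  rw [act_rotMat]
  simp [hexForm]
  ring

theorem hexForm_rotMat_pow (n : ℕ) (x : Fin 2 → ℤ) :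
    hexForm (act (rotMat ^ n) x) = hexForm x := by
  induction n with
  | zero => rw [pow_zero, act_one]
  | succ n ih => rw [pow_succ', act_mul, hexForm_rotMat, ih]

theorem hexForm_rotMat_pow_inv (n : ℕ) (x : Fin 2 → ℤ) :
    hexForm (act (rotMat ^ n)⁻¹ x) = hexForm x := by
  rw [← hexForm_rotMat_pow n, ← act_mul, mul_inv_cancel, act_one]

theorem prodForm_nonpos_of_hexForm_eq_one {x : Fin 2 → ℤ} (h : hexForm x = 1) :
    prodForm x ≤ 0 := by
  simp only [hexForm, prodForm] at *
  nlinarith [sq_nonneg (x 0 - x 1)]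

theorem prodForm_letterMat_inv (b : Bool) (x : Fin 2 → ℤ) :
    prodForm (act (letterMat b)⁻¹ x) =
      if b then x 0 * (x 1 - x 0) else (x 0 - x 1) * x 1 := by
  cases b
  · have h : U⁻¹.1 = !![1, -1; 0, 1] := by decide
    simp [prodForm, act, letterMat, h, Matrix.mulVec, dotProduct, Fin.sum_univ_two,
      -Matrix.SpecialLinearGroup.coe_inv, sub_eq_add_neg]
  · have h : V.1 = !![1, 0; -1, 1] := by decide
    simp [prodForm, act, letterMat, h, Matrix.mulVec, dotProduct, Fin.sum_univ_two,
      sub_eq_neg_add]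

theorem prodForm_nonneg_of_wordMat_inv (W : List Bool) (x : Fin 2 → ℤ)
    (h : 0 ≤ prodForm (act (wordMat W)⁻¹ x)) : 0 ≤ prodForm x := by
  induction W generalizing x with
  | nil => simpa [wordMat, act_one] using h
  | cons b W ih =>
    rw [wordMat_cons, mul_inv_rev, act_mul] at h
    have := ih _ h
    rw [prodForm_letterMat_inv] at this
    unfold prodForm
    cases b
    · simp only [Bool.false_eq_true, if_false] at this
      nlinarith [sq_nonneg (x 1)]
    · simp only [if_true] at this
      nlinarith [sq_nonneg (x 0)]

theorem prodForm_pos_of_wordMat_inv (W : List Bool) (x : Fin 2 → ℤ)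
    (h : 0 < prodForm (act (wordMat W)⁻¹ x)) : 0 < prodForm x := by
  induction W generalizing x with
  | nil => simpa [wordMat, act_one] using h
  | cons b W ih =>
    rw [wordMat_cons, mul_inv_rev, act_mul] at h
    have := ih _ h
    rw [prodForm_letterMat_inv] at this
    unfold prodForm
    cases b
    · simp only [Bool.false_eq_true, if_false] at this
      nlinarith [sq_nonneg (x 1)]
    · simp only [if_true] at this
      nlinarith [sq_nonneg (x 0)]

theorem prodForm_wordMat_inv_nonpos (W W' : List Bool) (h₁ : ¬ W <+: W') (h₂ : ¬ W' <+: W)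
    (x : Fin 2 → ℤ) (h : 0 ≤ prodForm (act (wordMat W)⁻¹ x)) :
    prodForm (act (wordMat W')⁻¹ x) ≤ 0 := by
  induction W generalizing W' x with
  | nil => exact absurd W'.nil_prefix h₁
  | cons b W ih =>
    cases W' with
    | nil => exact absurd (List.nil_prefix) h₂
    | cons b' W' =>
      rw [wordMat_cons, mul_inv_rev, act_mul] at h ⊢
      by_cases hb : b = b'
      · subst hb
        simp only [List.cons_prefix_cons, true_and] at h₁ h₂
        exact ih W' h₁ h₂ _ h
      · by_contra! hpos
        have h₃ := prodForm_nonneg_of_wordMat_inv _ _ h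
        have h₄ := prodForm_pos_of_wordMat_inv _ _ hpos
        rw [prodForm_letterMat_inv] at h₃ h₄
        cases b <;> cases b' <;> simp at hb h₃ h₄ <;> nlinarith [sq_nonneg (x 0 - x 1)]

theorem prodForm_rotMat_pow_inv (i : Fin 3) (x : Fin 2 → ℤ) :
    prodForm (act (rotMat ^ (i : ℕ))⁻¹ x) =
      ![x 0 * x 1, -(x 1 * (x 0 + x 1)), -((x 0 + x 1) * x 0)] i := by
  have h₁ : (rotMat ^ 1)⁻¹.1 = !![0, -1; 1, 1] := by decide
  have h₂ : (rotMat ^ 2)⁻¹.1 = !![-1, -1; 1, 0] := by decide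
  fin_cases i
  · simp [act_one, prodForm]
  · change prodForm (Matrix.mulVec (rotMat ^ 1)⁻¹.1 x) = _
    rw [h₁]
    simp [prodForm, Matrix.mulVec, dotProduct, Fin.sum_univ_two]
  · change prodForm (Matrix.mulVec (rotMat ^ 2)⁻¹.1 x) = _
    rw [h₂]
    simp [prodForm, Matrix.mulVec, dotProduct, Fin.sum_univ_two]
    ring

/-- The quadratic form which is nonnegative exactly on the cone spanned by the columns. -/
def coneForm (M : SL2Z) (x : Fin 2 → ℤ) : ℤ := prodForm (act M⁻¹ x)

theorem coneForm_coneMat (c : Cone) (x : Fin 2 → ℤ) :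
    coneForm (coneMat c) x =
      prodForm (act (wordMat c.2)⁻¹ (act (rotMat ^ (c.1 : ℕ))⁻¹ x)) := by
  rw [coneForm, coneMat, mul_inv_rev, act_mul]

theorem coneForm_nonpos_of_disjoint {c d : Cone} (h₁ : ¬ c.Contains d) (h₂ : ¬ d.Contains c)
    {x : Fin 2 → ℤ} (h : 0 ≤ coneForm (coneMat c) x) : coneForm (coneMat d) x ≤ 0 := by
  rw [coneForm_coneMat] at h ⊢
  obtain ⟨i, W⟩ := c
  obtain ⟨j, W'⟩ := d
  by_cases hij : i = j
  · subst hij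
    simp only [Cone.Contains, true_and] at h₁ h₂
    exact prodForm_wordMat_inv_nonpos W W' h₁ h₂ _ h
  · by_contra! hpos
    have h₃ := prodForm_nonneg_of_wordMat_inv _ _ h
    have h₄ := prodForm_pos_of_wordMat_inv _ _ hpos
    simp only [prodForm_rotMat_pow_inv] at h₃ h₄
    fin_cases i <;> fin_cases j <;> simp at hij h₃ h₄ <;>
      nlinarith [sq_nonneg (x 0), sq_nonneg (x 1), sq_nonneg (x 0 + x 1)]

theorem coneForm_nonpos_of_hexForm_eq_one (c : Cone) {x : Fin 2 → ℤ} (h : hexForm x = 1) :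
    coneForm (coneMat c) x ≤ 0 := by
  rw [coneForm_coneMat]
  by_contra! hpos
  have h₁ := prodForm_pos_of_wordMat_inv _ _ hpos
  rw [← hexForm_rotMat_pow_inv c.1] at h
  exact absurd (prodForm_nonpos_of_hexForm_eq_one h) h₁.not_ge

namespace Region

theorem coneForm_outCone (r : Region) (x : Fin 2 → ℤ) :
    coneForm (coneMat r.outCone) (act r.transvection x) = -coneForm (coneMat r.inCone) x := by
  have hJ : flipMat.1 = !![0, 1; -1, 0] := rfl
  have key : coneForm (coneMat r.outCone)
      (act (coneMat r.outCone * flipMat * (coneMat r.inCone)⁻¹) x) =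
        -coneForm (coneMat r.inCone) x := by
    rw [coneForm, ← act_mul, ← mul_assoc, inv_mul_cancel_left, act_mul, coneForm]
    generalize act (coneMat r.inCone)⁻¹ x = y
    simp [prodForm, act, hJ, Matrix.mulVec, dotProduct, Fin.sum_univ_two, mul_comm]
  rcases r.transvection_eq with h | h
  · rw [h, key]
  · rw [h, act_neg, ← key]
    simp only [coneForm, act, Matrix.mulVec_neg, prodForm_neg]

/-- No Hurwitz move on the pair of regions is known to simplify it. -/
def Disjoint (v w : Region) : Prop :=
  ¬ w.outCone.Contains v.inCone ∧ ¬ v.inCone.Contains w.outCone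

theorem coneForm_outCone_prod_nonneg (r : Region) (R : List Region)
    (hR : List.IsChain Disjoint (r :: R)) {x : Fin 2 → ℤ} (hx : hexForm x = 1) :
    0 ≤ coneForm (coneMat r.outCone) (act ((r :: R).map transvection).prod x) := by
  induction R generalizing r with
  | nil =>
    simp only [List.map_cons, List.map_nil, List.prod_cons, List.prod_nil, mul_one]
    rw [coneForm_outCone]
    exact neg_nonneg.mpr (coneForm_nonpos_of_hexForm_eq_one _ hx)
  | cons s R ih =>
    rw [List.isChain_cons_cons] at hR
    rw [List.map_cons, List.prod_cons, act_mul, coneForm_outCone]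
    exact neg_nonneg.mpr (coneForm_nonpos_of_disjoint hR.1.1 hR.1.2 (ih s hR.2))

/-- A ping-pong argument: a nonempty product over a chain of disjoint regions moves the base
triangle. -/
theorem eq_nil_of_isChain_disjoint (R : List Region) (hR : List.IsChain Disjoint R)
    (h : ∀ x, hexForm (act (R.map transvection).prod x) = hexForm x) : R = [] := by
  cases R with
  | nil => rfl
  | cons r R =>
    exfalso
    set P := ((r :: R).map transvection).prod with hP
    set n : ℕ := (r.outCone.1 : ℕ)
    set y : Fin 2 → ℤ := act (rotMat ^ n) ![1, -1] with hy
    have hx : hexForm (act P⁻¹ y) = 1 := by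
      rw [← h, ← act_mul, mul_inv_cancel, act_one, hy, hexForm_rotMat_pow]
      simp [hexForm]
    have h₁ := coneForm_outCone_prod_nonneg r R hR hx
    rw [← hP, ← act_mul, mul_inv_cancel, act_one, coneForm_coneMat] at h₁
    have h₂ := prodForm_nonneg_of_wordMat_inv _ _ h₁
    rw [hy, ← act_mul, inv_mul_cancel, act_one] at h₂
    simp [prodForm] at h₂

theorem not_disjoint_cases {v w : Region} (h : ¬ Disjoint v w) :
    (∃ w' : Region, w'.transvection = v.transvection * w.transvection * v.transvection⁻¹ ∧
      w'.depth < w.depth) ∨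
    (∃ v' : Region, v'.transvection = w.transvection⁻¹ * v.transvection * w.transvection ∧
      v'.depth < v.depth) ∨
    ∃ i, v = base i ∧ w = base (i + 1) := by
  have left {X : List Bool} (hw : w = node (v.inCone.1, v.inCone.2 ++ X)) :
      ∃ w' : Region, w'.transvection = v.transvection * w.transvection * v.transvection⁻¹ ∧
        w'.depth < w.depth := by
    subst hw
    exact exists_conj_depth_lt v X
  have right {X : List Bool} (hv : v = node (w.outCone.1, w.outCone.2 ++ X)) :
      ∃ v' : Region, v'.transvection = w.transvection⁻¹ * v.transvection * w.transvection ∧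
        v'.depth < v.depth := by
    subst hv
    simpa only [MulAut.conj_apply, inv_inv] using exists_conj_inv_depth_lt w X
  rw [Disjoint, not_and_or, not_not, not_not] at h
  rcases h with ⟨h₁, h₂⟩ | ⟨h₁, h₂⟩
  · cases v with
    | base i =>
      cases w with
      | base j => exact Or.inr (Or.inr ⟨i, rfl, by simpa [outCone, inCone] using h₁⟩)
      | node d => simp [outCone, inCone] at h₂
    | node c =>
      right; left
      simp only [inCone] at h₁ h₂
      rcases List.prefix_concat_iff.mp h₂ with h₂ | ⟨X, hX⟩
      · cases w <;> simp [outCone] at h₂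
      · exact right (X := X) (by rw [hX, h₁])
  · cases w with
    | base j =>
      cases v with
      | base i => exact Or.inr (Or.inr ⟨i, rfl, by simpa [outCone, inCone] using h₁.symm⟩)
      | node c => simp [outCone, inCone] at h₂
    | node d =>
      left
      simp only [outCone] at h₁ h₂
      rcases List.prefix_concat_iff.mp h₂ with h₂ | ⟨X, hX⟩
      · cases v <;> simp [inCone] at h₂
      · exact left (X := X) (by rw [hX, h₁])

theorem hurwitzEquiv_base (i : Fin 3) :
    HurwitzEquiv [(base i).transvection, (base (i + 1)).transvection] [V, U] := by
  have h₀ : HurwitzEquiv [(base 2).transvection, (base 0).transvection] [V, U] := by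
    have h : [(base 2).transvection, (base 0).transvection] = [V, U] := by decide
    rw [h]
    exact Relation.ReflTransGen.refl
  have h₁ : HurwitzEquiv [(base 0).transvection, (base 1).transvection] [V, U] :=
    Relation.ReflTransGen.head ⟨[], _, _, [], rfl, Or.inr (by decide)⟩ h₀
  have h₂ : HurwitzEquiv [(base 1).transvection, (base 2).transvection] [V, U] :=
    Relation.ReflTransGen.head ⟨[], _, _, [], rfl, Or.inr rfl⟩ (by
      have h : (base 1).transvection * (base 2).transvection * (base 1).transvection⁻¹ =
        (base 0).transvection := by decide
      rw [h]
      exact h₁)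
  fin_cases i
  · exact h₁
  · exact h₂
  · exact h₀

theorem transvection_rotate_rotate (r : Region) :
    r.rotate.rotate.transvection = (V * U)⁻¹ * r.transvection * (V * U) := by
  have h : rotMat * rotMat = -(V * U)⁻¹ := by decide
  rw [transvection_rotate, transvection_rotate, ← MulAut.mul_apply, ← map_mul, h, conj_neg_eq,
    MulAut.conj_apply, inv_inv]

/-- Every list of transvections is Hurwitz equivalent to a power of the pair `(V, U)` followed by
a chain of disjoint regions. -/
theorem exists_hurwitzEquiv_isChain (R : List Region) :
    ∃ (k : ℕ) (R' : List Region), List.IsChain Disjoint R' ∧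
      HurwitzEquiv (R.map transvection)
        ((List.replicate k [V, U]).flatten ++ R'.map transvection) := by
  induction hn : (R.map fun r => r.depth + 1).sum using Nat.strong_induction_on generalizing R with
  | _ n ih =>
  by_cases hR : List.IsChain Disjoint R
  · exact ⟨0, R, hR, Relation.ReflTransGen.refl⟩
  rw [List.isChain_iff_forall_rel_of_append_cons_cons] at hR
  push Not at hR
  obtain ⟨v, w, p, t, rfl, hvw⟩ := hR
  have step (R₁ : List Region)
      (hlt : (R₁.map fun r => r.depth + 1).sum < n)
      (hmove : HurwitzMove ((p ++ v :: w :: t).map transvection) (R₁.map transvection)) :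
      ∃ (k : ℕ) (R' : List Region), List.IsChain Disjoint R' ∧
        HurwitzEquiv ((p ++ v :: w :: t).map transvection)
          ((List.replicate k [V, U]).flatten ++ R'.map transvection) := by
    obtain ⟨k, R', h₁, h₂⟩ := ih _ hlt R₁ rfl
    exact ⟨k, R', h₁, Relation.ReflTransGen.head hmove h₂⟩
  rcases not_disjoint_cases hvw with ⟨w', hw', hlt⟩ | ⟨v', hv', hlt⟩ | ⟨i, rfl, rfl⟩
  · refine step (p ++ w' :: v :: t) ?_ ⟨p.map transvection, v.transvection, w.transvection,
      t.map transvection, by simp, Or.inr (by simp [hw'])⟩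
    rw [← hn]
    simp only [List.map_append, List.map_cons, List.sum_append, List.sum_cons]
    omega
  · refine step (p ++ w :: v' :: t) ?_ ⟨p.map transvection, v.transvection, w.transvection,
      t.map transvection, by simp, Or.inl (by simp [hv'])⟩
    rw [← hn]
    simp only [List.map_append, List.map_cons, List.sum_append, List.sum_cons]
    omega
  · obtain ⟨k, R', h₁, h₂⟩ := ih _ (by
      rw [← hn]
      simp only [List.map_append, List.map_cons, List.sum_append, List.sum_cons, List.map_map,
        Function.comp_def, depth_rotate]
      omega) (p.map (fun r => r.rotate.rotate) ++ t) rfl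
    refine ⟨k + 1, R', h₁, ?_⟩
    have e₁ := (hurwitzEquiv_base i).append (p.map transvection) (t.map transvection)
    have e₂ := (HurwitzEquiv.pair_to_front (p.map transvection) V U).append []
      (t.map transvection)
    have e₃ := h₂.append [V, U] []
    refine HurwitzEquiv.trans ?_ (e₂.trans ?_)
    · simpa using e₁
    · simpa [List.replicate_succ, Function.comp_def, transvection_rotate_rotate, mul_assoc]
        using e₃

theorem exists_map_transvection (L : List SL2Z) (hconj : ∀ A ∈ L, IsConj U A) :
    ∃ R : List Region, R.map transvection = L := by
  induction L with
  | nil => exact ⟨[], rfl⟩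
  | cons A L ih =>
    obtain ⟨R, rfl⟩ := ih fun B hB => hconj B (List.mem_cons_of_mem _ hB)
    obtain ⟨r, rfl⟩ := exists_transvection_eq (hconj A List.mem_cons_self)
    exact ⟨r :: R, rfl⟩

end Region

/-- Any factorization of `-(VU)²` into conjugates of `U` is Hurwitz equivalent to a power of the
pair `(V, U)`. -/
theorem exists_hurwitzEquiv_replicate (L : List SL2Z) (hconj : ∀ A ∈ L, IsConj U A)
    (hprod : L.prod = -((V * U) ^ 2)) :
    ∃ k : ℕ, HurwitzEquiv L (List.replicate k [V, U]).flatten := by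
  obtain ⟨R, rfl⟩ := Region.exists_map_transvection L hconj
  obtain ⟨k, R', hR', hequiv⟩ := Region.exists_hurwitzEquiv_isChain R
  suffices R' = [] by
    subst this
    exact ⟨k, by simpa using hequiv⟩
  refine Region.eq_nil_of_isChain_disjoint R' hR' fun x => ?_
  have h := hequiv.prod_eq
  have hk : ((List.replicate k [V, U]).flatten).prod = rotMat ^ k := by
    simp [List.prod_flatten, rotMat]
  rw [List.prod_append, hk, hprod] at h
  rw [← hexForm_rotMat_pow k, ← act_mul, h, act_neg, hexForm_neg]
  exact hexForm_rotMat_pow 2 x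

/-- Kodaira type IV*: any factorization of `-(VU)²` into conjugates of `U` has `r ≥ 10` factors and Hurwitz moves bring it to `(V, U, V, U, D₅, …, Dᵣ)` with `D₅⋯Dᵣ = -1`. -/
theorem normal_factorization_IVstar (L : List SL2Z)
    (hconj : ∀ A ∈ L, IsConj U A)
    (hprod : L.prod = -((V * U) ^ 2)) :
    10 ≤ L.length ∧
    ∃ D : List SL2Z,
      HurwitzEquiv L ([V, U, V, U] ++ D) ∧ D.prod = -(1 : SL2Z) := by
  obtain ⟨k, hk⟩ := exists_hurwitzEquiv_replicate L hconj hprod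
  have hp : (V * U) ^ k = -((V * U) ^ 2) := by
    rw [← hprod, ← hk.prod_eq]
    simp [List.prod_flatten]
  have hk5 : 5 ≤ k := by
    by_contra! hlt
    have h : ∀ j : Fin 5, (V * U) ^ (j : ℕ) ≠ -((V * U) ^ 2) := by decide
    exact h ⟨k, hlt⟩ hp
  obtain ⟨m, rfl⟩ := Nat.exists_eq_add_of_le' (show 2 ≤ k by omega)
  refine ⟨?_, (List.replicate m [V, U]).flatten, by simpa [List.replicate_succ] using hk, ?_⟩
  · rw [← hk.length_eq]
    simp [List.length_flatten]
    omega
  · have h : (List.replicate m [V, U]).flatten.prod = (V * U) ^ m := by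
      simp [List.prod_flatten]
    rw [h]
    rw [pow_add, ← neg_one_mul ((V * U) ^ 2)] at hp
    exact mul_right_cancel hp
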